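/- Let (W,S) be a Coxeter system, J ⊆ S, and δ : W_J → W_{J'} an automorphism with δ(J) = J'. For w ∈ {}^J W (the minimal length coset representatives for W_J\W), let I(J,w,δ) = max{J₁ ⊆ J : Ad(w)δ(J₁) = J₁}. Then W is the disjoint union over w ∈ {}^J W of the δ-twisted W_J-conjugacy orbits W_J ·_δ (W_{I(J,w,δ)} w). -/

import Mathlib

open CoxeterSystem

variable {B : Type*} {W : Type*} [Group W] {M : CoxeterMatrix B}

/-- The set `ᴶW` of minimal length representatives of the cosets `W_J x`. -/
def MinCosetRep (cs : CoxeterSystem M W) (J : Set B) : Set W :=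
  {w | ∀ u ∈ Subgroup.closure (cs.simple '' J), cs.length w ≤ cs.length (u * w)}

/-- `Ad(w)δ(K) = K`: for every `s ∈ K` there is `s' ∈ K` with `w δ(s) w⁻¹ = s'`. -/
def AdStable (cs : CoxeterSystem M W) (δ : W →* W) (w : W) (K : Set B) : Prop :=
  ∀ i ∈ K, ∃ i' ∈ K, w * δ (cs.simple i) * w⁻¹ = cs.simple i'

/-- `I(J, w, δ)`: the largest subset `J₁ ⊆ J` with `Ad(w)δ(J₁) = J₁`. -/
def Iset (cs : CoxeterSystem M W) (δ : W →* W) (J : Set B) (w : W) : Set B :=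
  ⋃₀ {K : Set B | K ⊆ J ∧ AdStable cs δ w K}

/-- The piece `W_J ·_δ (W_{I(J,w,δ)} w)` of the partial twisted conjugation action. -/
def Piece (cs : CoxeterSystem M W) (δ : W →* W) (J : Set B) (w : W) : Set W :=
  {g | ∃ u ∈ Subgroup.closure (cs.simple '' J),
    ∃ v ∈ Subgroup.closure (cs.simple '' Iset cs δ J w),
      g = u * (v * w) * (δ u)⁻¹}

namespace PCD

open Classical in
/-- the sign permutation representation, as a function -/
noncomputable def sg (cs : CoxeterSystem M W) (i : B) (p : W × ZMod 2) : W × ZMod 2 :=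
  (cs.simple i * p.1 * cs.simple i, p.2 + if p.1 = cs.simple i then 1 else 0)

lemma sg_sg (cs : CoxeterSystem M W) (i j : B) (p : W × ZMod 2) :
    sg cs i (sg cs j p) = ((cs.simple i * cs.simple j) * p.1 * (cs.simple i * cs.simple j)⁻¹,
      p.2 + open Classical in ((if p.1 = cs.simple j then 1 else 0) +
        (if p.1 = cs.simple j * (cs.simple i * cs.simple j) then 1 else 0))) := by
  have h : (cs.simple j * p.1 * cs.simple j = cs.simple i) ↔
      (p.1 = cs.simple j * (cs.simple i * cs.simple j)) := by
    constructor
    · intro h; rw [← h]; simp [mul_assoc]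
    · intro h; rw [h]; simp [mul_assoc]
  by_cases h' : cs.simple j * p.1 * cs.simple j = cs.simple i
  · simp [sg, if_pos (h.1 h'), mul_assoc, add_assoc]; exact if_pos h'
  · simp [sg, if_neg (mt h.2 h'), mul_assoc, add_assoc]; exact if_neg h'

lemma refl_pow (cs : CoxeterSystem M W) (i j : B) (n : ℕ) :
    (cs.simple i * cs.simple j)^n * cs.simple j * (cs.simple i * cs.simple j)^n = cs.simple j := by
  induction n with
  | zero => simp
  | succ n ih =>
    rw [pow_succ']
    nth_rewrite 2 [← pow_succ']
    rw [pow_succ]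
    calc _ = (cs.simple i * cs.simple j) * ((cs.simple i * cs.simple j)^n * cs.simple j *
        (cs.simple i * cs.simple j)^n) * (cs.simple i * cs.simple j) := by simp only [mul_assoc]
      _ = _ := by rw [ih]; simp [mul_assoc]

lemma conj_iff (cs : CoxeterSystem M W) (i j : B) (n k : ℕ) (t : W) :
    ((cs.simple i * cs.simple j)^n * t * ((cs.simple i * cs.simple j)^n)⁻¹ =
      cs.simple j * (cs.simple i * cs.simple j)^k) ↔
      t = cs.simple j * (cs.simple i * cs.simple j)^(2*n+k) := by
  have h := refl_pow cs i j n
  set r := cs.simple i * cs.simple j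
  have h2 : cs.simple j * r^n = (r^n)⁻¹ * cs.simple j := by
    rw [← h]; simp only [← mul_assoc]; simp [mul_assoc, h]
  rw [mul_inv_eq_iff_eq_mul, ← eq_inv_mul_iff_mul_eq]
  have : (r ^ n)⁻¹ * (cs.simple j * r ^ k * r ^ n) = cs.simple j * r ^ (2 * n + k) := by
    rw [← mul_assoc, ← mul_assoc, ← h2, mul_assoc, mul_assoc, ← pow_add, ← pow_add]
    congr 2; omega
  rw [this]

open Classical in
lemma sg_iter (cs : CoxeterSystem M W) (i j : B) (n : ℕ) (p : W × ZMod 2) :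
    (fun q => sg cs i (sg cs j q))^[n] p =
      ((cs.simple i * cs.simple j)^n * p.1 * ((cs.simple i * cs.simple j)^n)⁻¹,
      p.2 + ∑ k ∈ Finset.range (2*n),
        if p.1 = cs.simple j * (cs.simple i * cs.simple j)^k then (1 : ZMod 2) else 0) := by
  induction n with
  | zero => simp
  | succ n ih =>
    rw [Function.iterate_succ_apply', ih, sg_sg]
    have h0 := conj_iff cs i j n 0 p.1
    have h1 := conj_iff cs i j n 1 p.1
    simp only [pow_zero, mul_one, pow_one, add_zero] at h0 h1
    simp only [h0, h1]
    rw [show 2*(n+1) = 2*n+1+1 by ring, Finset.sum_range_succ, Finset.sum_range_succ]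
    ext
    · simp [pow_succ', mul_assoc]
    · simp [add_assoc]

/-- `sg` as an endomorphism -/
noncomputable def sgE (cs : CoxeterSystem M W) (i : B) : Function.End (W × ZMod 2) := sg cs i

lemma liftable (cs : CoxeterSystem M W) :
    M.IsLiftable (sgE cs) := by
  intro i j
  funext p
  have h : (sgE cs i * sgE cs j) ^ (M i j)
      = (fun q => sg cs i (sg cs j q))^[M i j] := by
    generalize M i j = n
    induction n with
    | zero => rfl
    | succ n ih => rw [pow_succ, ih]; rfl
  have h2 := sg_iter cs i j (M i j) p
  rw [h, h2]
  clear h h2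
  have hp : (cs.simple i * cs.simple j) ^ (M i j) = 1 := cs.simple_mul_simple_pow i j
  generalize M i j = m at hp ⊢
  change _ = p
  rw [two_mul, Finset.sum_range_add]
  have hq : ∀ x, (cs.simple i * cs.simple j) ^ (m + x) = (cs.simple i * cs.simple j) ^ x := by
    intro x; rw [pow_add, hp, one_mul]
  have hs : ∀ f g : ℕ → ZMod 2, (∀ x, g x = f x) →
      ∑ x ∈ Finset.range m, f x + ∑ x ∈ Finset.range m, g x = 0 := by
    intro f g hfg
    rw [Finset.sum_congr rfl (fun x _ => hfg x)]
    exact CharTwo.add_self_eq_zero _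
  rw [hs _ _ (fun x => by rw [hq]), hp]
  ext <;> simp

noncomputable def rho (cs : CoxeterSystem M W) : W →* Function.End (W × ZMod 2) :=
  cs.lift ⟨_, liftable cs⟩

lemma rho_simple (cs : CoxeterSystem M W) (i : B) : rho cs (cs.simple i) = sgE cs i :=
  cs.lift_apply_simple (liftable cs) i

lemma rho_mul (cs : CoxeterSystem M W) (a b : W) (p) :
    rho cs (a * b) p = rho cs a (rho cs b p) := by rw [map_mul]; rfl

lemma rho_word (cs : CoxeterSystem M W) (ω : List B) (t : W) (e : ZMod 2) :
    (rho cs (cs.wordProd ω) (t, e)).1 = cs.wordProd ω * t * (cs.wordProd ω)⁻¹ ∧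
    (t ∉ cs.rightInvSeq ω → (rho cs (cs.wordProd ω) (t, e)).2 = e) := by
  induction ω with
  | nil =>
    have : rho cs (cs.wordProd []) (t, e) = (t, e) := by rw [cs.wordProd_nil, map_one]; rfl
    rw [this]; simp
  | cons i ω ih =>
    rw [cs.wordProd_cons, rho_mul, rho_simple, sgE]
    constructor
    · simp [sg, ih.1, mul_assoc]
    · intro h
      simp only [rightInvSeq, List.mem_cons, not_or] at h
      simp only [sg, ih.1, ih.2 h.2]
      rw [if_neg, add_zero]
      intro h'
      apply h.1
      rw [← h', ih.1]; group

lemma exchange_right (cs : CoxeterSystem M W) (ω : List B) (i : B)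
    (h : cs.length (cs.wordProd ω * cs.simple i) < cs.length (cs.wordProd ω)) :
    ∃ j < ω.length, cs.wordProd ω * cs.simple i = cs.wordProd (ω.eraseIdx j) := by
  have hm : cs.simple i ∈ cs.rightInvSeq ω := by
    by_contra hn
    have h1 := (rho_word cs ω (cs.simple i) 0).2 hn
    obtain ⟨ω0, hr, h0⟩ := cs.exists_isReduced (cs.wordProd ω * cs.simple i)
    have h3 : cs.wordProd ω = cs.wordProd ω0 * cs.simple i := by rw [← h0]; simp
    rw [h3, rho_mul, rho_simple, sgE] at h1
    have h4 : sg cs i (cs.simple i, 0) = (cs.simple i, 1) := by simp [sg]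
    rw [h4] at h1
    by_cases hm : cs.simple i ∈ cs.rightInvSeq ω0
    · have := (cs.isRightInversion_of_mem_rightInvSeq hr hm).2
      rw [← h3, ← h0] at this
      omega
    · rw [(rho_word cs ω0 (cs.simple i) 1).2 hm] at h1
      exact one_ne_zero h1
  obtain ⟨j, hj, e⟩ := List.mem_iff_getElem.1 hm
  refine ⟨j, by simpa using hj, ?_⟩
  rw [← cs.wordProd_mul_getD_rightInvSeq, List.getD_eq_getElem _ _ hj, e]

lemma exchange_left (cs : CoxeterSystem M W) (ω : List B) (i : B)
    (h : cs.length (cs.simple i * cs.wordProd ω) < cs.length (cs.wordProd ω)) :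
    ∃ j < ω.length, cs.simple i * cs.wordProd ω = cs.wordProd (ω.eraseIdx j) := by
  have hm : cs.simple i ∈ cs.leftInvSeq ω := by
    have h' := exchange_right cs ω.reverse i (by
      rw [cs.wordProd_reverse, ← cs.length_inv, cs.length_inv (cs.wordProd ω)]; simpa using h)
    obtain ⟨j, hj, e⟩ := h'
    rw [← cs.wordProd_mul_getD_rightInvSeq] at e
    have hj' : j < (cs.rightInvSeq ω.reverse).length := by simpa using hj
    rw [List.getD_eq_getElem _ _ hj', mul_right_inj] at e
    have : cs.simple i ∈ cs.rightInvSeq ω.reverse := e ▸ List.getElem_mem hj'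
    rw [cs.rightInvSeq_reverse] at this
    simpa using this
  obtain ⟨j, hj, e⟩ := List.mem_iff_getElem.1 hm
  refine ⟨j, by simpa using hj, ?_⟩
  rw [← cs.getD_leftInvSeq_mul_wordProd, List.getD_eq_getElem _ _ hj, e]

lemma mem_closure (cs : CoxeterSystem M W) (J : Set B) {ω : List B} (h : ∀ i ∈ ω, i ∈ J) :
    cs.wordProd ω ∈ Subgroup.closure (cs.simple '' J) := by
  induction ω with
  | nil => simp
  | cons i ω ih =>
    rw [cs.wordProd_cons]
    exact mul_mem (Subgroup.subset_closure ⟨i, h i (by simp), rfl⟩)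
      (ih fun k hk => h k (by simp [hk]))

lemma exists_word (cs : CoxeterSystem M W) (J : Set B) {a : W}
    (h : a ∈ Subgroup.closure (cs.simple '' J)) :
    ∃ ω : List B, (∀ i ∈ ω, i ∈ J) ∧ a = cs.wordProd ω := by
  induction h using Subgroup.closure_induction with
  | mem x hx => obtain ⟨i, hi, rfl⟩ := hx; exact ⟨[i], by simpa using hi, by simp⟩
  | one => exact ⟨[], by simp, by simp⟩
  | mul x y _ _ hx hy =>
    obtain ⟨a, ha, rfl⟩ := hx
    obtain ⟨b, hb, rfl⟩ := hy
    refine ⟨a ++ b, ?_, by rw [cs.wordProd_append]⟩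
    intro i hi
    rcases List.mem_append.1 hi with h | h
    · exact ha i h
    · exact hb i h
  | inv x _ hx =>
    obtain ⟨a, ha, rfl⟩ := hx
    exact ⟨a.reverse, by simpa using ha, by simp⟩

/-- Lengths add for a shortest `J`-word times a minimal representative. -/
lemma length_add (cs : CoxeterSystem M W) (J : Set B) {w : W} (hw : w ∈ MinCosetRep cs J)
    (ω : List B) (hJ : ∀ i ∈ ω, i ∈ J)
    (hmin : ∀ ω' : List B, (∀ i ∈ ω', i ∈ J) → cs.wordProd ω' = cs.wordProd ω →
      ω.length ≤ ω'.length) :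
    cs.length (cs.wordProd ω * w) = ω.length + cs.length w := by
  induction ω with
  | nil => simp
  | cons i ω ih =>
    have hJ' : ∀ k ∈ ω, k ∈ J := fun k hk => hJ k (by simp [hk])
    have hi : i ∈ J := hJ i (by simp)
    have ih := ih hJ' (by
      intro ω' h1 h2
      have := hmin (i :: ω') (by simpa [hi] using h1) (by simp [cs.wordProd_cons, h2])
      simpa using this)
    rw [cs.wordProd_cons, mul_assoc]
    rcases cs.length_simple_mul (cs.wordProd ω * w) i with h | h
    · rw [h, ih]; simp; ring
    · exfalso
      obtain ⟨ρ, hρ, rfl⟩ := cs.exists_isReduced w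
      rw [← cs.wordProd_append] at h
      obtain ⟨j, hj, e⟩ := exchange_left cs (ω ++ ρ) i (by omega)
      by_cases hjl : j < ω.length
      · rw [List.eraseIdx_append_of_lt_length hjl, cs.wordProd_append, cs.wordProd_append,
          ← mul_assoc, mul_left_inj] at e
        have := hmin (ω.eraseIdx j) (fun k hk => hJ' k (List.mem_of_mem_eraseIdx hk))
          (by rw [cs.wordProd_cons, e])
        have := List.length_eraseIdx_of_lt hjl
        simp at *
        omega
      · push Not at hjl
        rw [List.eraseIdx_append_of_length_le hjl, cs.wordProd_append, cs.wordProd_append] at e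
        have hm : (cs.wordProd ω)⁻¹ * (cs.simple i * cs.wordProd ω) ∈
            Subgroup.closure (cs.simple '' J) :=
          mul_mem (inv_mem (mem_closure cs J hJ')) (mul_mem
            (Subgroup.subset_closure ⟨i, hi, rfl⟩) (mem_closure cs J hJ'))
        have h2 := hw _ hm
        have h3 : (cs.wordProd ω)⁻¹ * (cs.simple i * cs.wordProd ω) * cs.wordProd ρ =
            cs.wordProd (ρ.eraseIdx (j - ω.length)) := by
          rw [mul_assoc, mul_assoc, e]; simp
        rw [h3, hρ.eq] at h2
        have h4 := cs.length_wordProd_le (ρ.eraseIdx (j - ω.length))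
        have hj2 : j - ω.length < ρ.length := by simp at hj; omega
        have := List.length_eraseIdx_of_lt hj2
        omega

lemma exists_shortest (cs : CoxeterSystem M W) (J : Set B) {a : W}
    (h : a ∈ Subgroup.closure (cs.simple '' J)) :
    ∃ ω : List B, (∀ i ∈ ω, i ∈ J) ∧ a = cs.wordProd ω ∧
      ∀ ω' : List B, (∀ i ∈ ω', i ∈ J) → cs.wordProd ω' = cs.wordProd ω →
      ω.length ≤ ω'.length := by
  classical
  have hex : ∃ n, ∃ ω : List B, (∀ i ∈ ω, i ∈ J) ∧ a = cs.wordProd ω ∧ ω.length = n := by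
    obtain ⟨ω, h1, h2⟩ := exists_word cs J h
    exact ⟨_, ω, h1, h2, rfl⟩
  obtain ⟨ω, h1, h2, h3⟩ := Nat.find_spec hex
  refine ⟨ω, h1, h2, fun ω' h4 h5 => ?_⟩
  rw [h3]
  exact Nat.find_min' hex ⟨ω', h4, by rw [h2, h5], rfl⟩

lemma exists_rep (cs : CoxeterSystem M W) (J : Set B) (g : W) :
    ∃ a ∈ Subgroup.closure (cs.simple '' J), ∃ w ∈ MinCosetRep cs J, g = a * w := by
  classical
  have hex : ∃ n, ∃ a ∈ Subgroup.closure (cs.simple '' J), cs.length (a * g) = n :=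
    ⟨_, 1, one_mem _, rfl⟩
  obtain ⟨a, ha, h⟩ := Nat.find_spec hex
  refine ⟨a⁻¹, inv_mem ha, a * g, fun u hu => ?_, by simp⟩
  rw [h]
  exact Nat.find_min' hex ⟨u * a, mul_mem hu ha, by rw [mul_assoc]⟩

lemma rep_unique (cs : CoxeterSystem M W) (J : Set B) {a w w' : W}
    (ha : a ∈ Subgroup.closure (cs.simple '' J)) (hw : w ∈ MinCosetRep cs J)
    (hw' : w' ∈ MinCosetRep cs J) (h : w' = a * w) : w' = w := by
  obtain ⟨ω, h1, rfl, h3⟩ := exists_shortest cs J ha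
  have h4 := length_add cs J hw ω h1 h3
  have h5 := hw' _ (inv_mem ha)
  rw [h, h4] at h5
  simp only [inv_mul_cancel_left] at h5
  have : ω = [] := List.length_eq_zero_iff.1 (by omega)
  subst this
  simpa using h

lemma deodhar (cs : CoxeterSystem M W) (J : Set B) {x : W} (hx : x ∈ MinCosetRep cs J) (t : B) :
    x * cs.simple t ∈ MinCosetRep cs J ∨ ∃ s ∈ J, x * cs.simple t = cs.simple s * x := by
  obtain ⟨a, ha, y, hy, e⟩ := exists_rep cs J (x * cs.simple t)
  obtain ⟨ω, h1, rfl, h3⟩ := exists_shortest cs J ha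
  have h4 := length_add cs J hy ω h1 h3
  cases ω with
  | nil => left; rw [e]; simpa using hy
  | cons s ω =>
    right
    have hs : s ∈ J := h1 s (by simp)
    refine ⟨s, hs, ?_⟩
    rw [← e] at h4
    have h5 : cs.simple s * (x * cs.simple t) = cs.wordProd ω * y := by
      rw [e, cs.wordProd_cons]; simp [mul_assoc]
    have h6 : cs.length (cs.simple s * (x * cs.simple t)) ≤ ω.length + cs.length y := by
      rw [h5]
      exact (cs.length_mul_le _ _).trans (Nat.add_le_add_right (cs.length_wordProd_le ω) _)
    have h7 : cs.length (cs.simple s * (x * cs.simple t)) < cs.length (x * cs.simple t) := by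
      simp at h4; omega
    obtain ⟨ρ, hρ, hxρ⟩ := cs.exists_isReduced x
    have h8 : x * cs.simple t = cs.wordProd (ρ ++ [t]) := by
      rw [cs.wordProd_append, ← hxρ]; simp
    rw [h8] at h7
    obtain ⟨j, hj, e2⟩ := exchange_left cs _ s h7
    by_cases hjl : j < ρ.length
    · exfalso
      rw [List.eraseIdx_append_of_lt_length hjl, cs.wordProd_append, cs.wordProd_append,
          ← mul_assoc, mul_left_inj, ← hxρ] at e2
      have h9 := hx _ (Subgroup.subset_closure ⟨s, hs, rfl⟩)
      rw [e2] at h9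
      have := cs.length_wordProd_le (ρ.eraseIdx j)
      have := List.length_eraseIdx_of_lt hjl
      have := hρ.eq
      rw [← hxρ] at this
      omega
    · push Not at hjl
      have : j = ρ.length := by simp at hj; omega
      subst this
      rw [List.eraseIdx_append_of_length_le le_rfl, ← h8] at e2
      simp at e2
      rw [← hxρ] at e2
      nth_rewrite 2 [← e2]
      simp

lemma transfer (cs : CoxeterSystem M W) (J J' : Set B) (δ : W →* W)
    (hδ : ∀ i ∈ J, ∃ i' ∈ J', δ (cs.simple i) = cs.simple i') (ω : List B) :
    ∀ x ∈ MinCosetRep cs J, (∀ i ∈ ω, i ∈ J) →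
    ∃ ω' : List B, ∃ y ∈ MinCosetRep cs J, (∀ i ∈ ω', i ∈ J) ∧
      x * δ (cs.wordProd ω) = cs.wordProd ω' * y ∧ ω'.length ≤ ω.length ∧
      (ω'.length = ω.length → y = x ∧
        ∀ i ∈ ω, ∃ i' ∈ ω', x * δ (cs.simple i) * x⁻¹ = cs.simple i') := by
  induction ω with
  | nil => intro x hx _; exact ⟨[], x, hx, by simp, by simp, by simp, by simp⟩
  | cons i ω ih =>
    intro x hx hJ
    have hJ' : ∀ k ∈ ω, k ∈ J := fun k hk => hJ k (by simp [hk])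
    obtain ⟨t, -, ht⟩ := hδ i (hJ i (by simp))
    rcases deodhar cs J hx t with h | ⟨s, hs, h⟩
    · obtain ⟨ω', y, hy, h1, h2, h3, -⟩ := ih _ h hJ'
      refine ⟨ω', y, hy, h1, ?_, by simp; omega, fun h => by simp at h; omega⟩
      rw [cs.wordProd_cons, map_mul, ht, ← h2, mul_assoc]
    · obtain ⟨ω', y, hy, h1, h2, h3, h4⟩ := ih _ hx hJ'
      refine ⟨s :: ω', y, hy, by simpa [hs] using h1, ?_, by simpa using h3, ?_⟩
      · rw [cs.wordProd_cons, cs.wordProd_cons, map_mul, ht, ← mul_assoc, h, mul_assoc, h2,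
          mul_assoc]
      · intro h5
        obtain ⟨h6, h7⟩ := h4 (by simpa using h5)
        refine ⟨h6, fun k hk => ?_⟩
        rcases List.mem_cons.1 hk with rfl | hk
        · exact ⟨s, by simp, by rw [ht, h]; simp⟩
        · obtain ⟨i', h8, h9⟩ := h7 k hk
          exact ⟨i', by simp [h8], h9⟩

lemma Iset_sub (cs : CoxeterSystem M W) (δ : W →* W) (J : Set B) (w : W) :
    Subgroup.closure (cs.simple '' Iset cs δ J w) ≤ Subgroup.closure (cs.simple '' J) :=
  Subgroup.closure_mono (Set.image_mono (Set.sUnion_subset fun _ hK => hK.1))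

lemma Iset_conj (cs : CoxeterSystem M W) (δ : W →* W) (J : Set B) (w : W) {v : W}
    (hv : v ∈ Subgroup.closure (cs.simple '' Iset cs δ J w)) :
    ∃ v' ∈ Subgroup.closure (cs.simple '' Iset cs δ J w), w * δ v = v' * w := by
  refine ⟨w * δ v * w⁻¹, ?_, by simp⟩
  induction hv using Subgroup.closure_induction with
  | mem x hx =>
    obtain ⟨i, ⟨K, hK, hi⟩, rfl⟩ := hx
    obtain ⟨i', hi', e⟩ := hK.2 i hi
    rw [e]
    exact Subgroup.subset_closure ⟨i', ⟨K, hK, hi'⟩, rfl⟩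
  | one => simp
  | mul x y _ _ hx hy => simpa [mul_assoc] using mul_mem hx hy
  | inv x _ hx => simpa [mul_assoc] using inv_mem hx

lemma existence (cs : CoxeterSystem M W) (J J' : Set B) (δ : W →* W)
    (hδ : ∀ i ∈ J, ∃ i' ∈ J', δ (cs.simple i) = cs.simple i') (g : W) :
    ∃ w : W, w ∈ MinCosetRep cs J ∧ g ∈ Piece cs δ J w := by
  classical
  let Q : W → List B → Prop := fun x ω => x ∈ MinCosetRep cs J ∧ (∀ i ∈ ω, i ∈ J) ∧
    ∃ u ∈ Subgroup.closure (cs.simple '' J), g = u * (cs.wordProd ω * x) * (δ u)⁻¹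
  have hex : ∃ n, ∃ x ω, Q x ω ∧ ω.length = n := by
    obtain ⟨a, ha, w, hw, e⟩ := exists_rep cs J g
    obtain ⟨ω, h1, rfl⟩ := exists_word cs J ha
    exact ⟨_, w, ω, ⟨hw, h1, 1, one_mem _, by simp [e]⟩, rfl⟩
  obtain ⟨x, ω, hQ, hn⟩ := Nat.find_spec hex
  have hmin : ∀ y ω', Q y ω' → ω.length ≤ ω'.length := fun y ω' h => by
    rw [hn]; exact Nat.find_min' hex ⟨y, ω', h, rfl⟩
  let K : Set B := {i | ∃ ω', Q x ω' ∧ ω'.length = ω.length ∧ i ∈ ω'}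
  have hK : K ⊆ Iset cs δ J x := by
    refine Set.subset_sUnion_of_mem ⟨?_, ?_⟩
    · rintro i ⟨ω', h, -, hi⟩; exact h.2.1 i hi
    · rintro i ⟨ω1, h, hl, hi⟩
      obtain ⟨hx, h1, u, hu, e⟩ := h
      obtain ⟨ω2, y, hy, h2, h3, h4, h5⟩ := transfer cs J J' δ hδ ω1 x hx h1
      have hQ2 : Q y ω2 := by
        refine ⟨hy, h2, u * cs.wordProd ω1, mul_mem hu (mem_closure cs J h1), ?_⟩
        rw [← h3, e, map_mul]; group
      have h6 := hmin _ _ hQ2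
      obtain ⟨rfl, h7⟩ := h5 (by omega)
      obtain ⟨i', hi', e'⟩ := h7 i hi
      exact ⟨i', ⟨ω2, hQ2, by omega, hi'⟩, e'⟩
  have hQ' := hQ
  obtain ⟨hx, h1, u, hu, e⟩ := hQ'
  exact ⟨x, hx, u, hu, cs.wordProd ω, mem_closure cs _ fun i hi => hK ⟨ω, hQ, rfl, hi⟩, e⟩

lemma uniqueness (cs : CoxeterSystem M W) (J J' : Set B) (δ : W →* W)
    (hδ : ∀ i ∈ J, ∃ i' ∈ J', δ (cs.simple i) = cs.simple i') (g w w' : W)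
    (hw : w ∈ MinCosetRep cs J) (hw' : w' ∈ MinCosetRep cs J)
    (hg : g ∈ Piece cs δ J w) (hg' : g ∈ Piece cs δ J w') : w' = w := by
  classical
  let Q : List B → Prop := fun ω => (∀ i ∈ ω, i ∈ J) ∧
    ∃ v ∈ Subgroup.closure (cs.simple '' Iset cs δ J w),
    ∃ v' ∈ Subgroup.closure (cs.simple '' Iset cs δ J w'),
      w * δ (cs.wordProd ω) = v * cs.wordProd ω * v' * w'
  have hex : ∃ n, ∃ ω, Q ω ∧ ω.length = n := by
    obtain ⟨u, hu, v, hv, e⟩ := hg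
    obtain ⟨u', hu', v', hv', e'⟩ := hg'
    obtain ⟨ω, h1, h2⟩ := exists_word cs J (mul_mem (inv_mem hu) hu')
    refine ⟨_, ω, ⟨h1, v⁻¹, inv_mem hv, v', hv', ?_⟩, rfl⟩
    rw [← h2]
    have h3 : v * w * (δ u)⁻¹ * δ u' = u⁻¹ * u' * v' * w' := by
      have : v * w * (δ u)⁻¹ = u⁻¹ * g := by rw [e]; group
      rw [this, e']; group
    calc w * δ (u⁻¹ * u') = v⁻¹ * (v * w * (δ u)⁻¹ * δ u') := by rw [map_mul, map_inv]; group
      _ = _ := by rw [h3]; group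
  obtain ⟨ω, hQ, hn⟩ := Nat.find_spec hex
  have hmin : ∀ ω', Q ω' → ω.length ≤ ω'.length := fun ω' h => by
    rw [hn]; exact Nat.find_min' hex ⟨ω', h, rfl⟩
  obtain ⟨h1, v, hv, v', hv', e⟩ := hQ
  obtain ⟨ω', y, hy, h2, h3, h4, h5⟩ := transfer cs J J' δ hδ ω w hw h1
  have hc : v * cs.wordProd ω * v' ∈ Subgroup.closure (cs.simple '' J) :=
    mul_mem (mul_mem (Iset_sub cs δ J w hv) (mem_closure cs J h1)) (Iset_sub cs δ J w' hv')
  have hy' : y = w' := by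
    refine rep_unique cs J (mul_mem (inv_mem (mem_closure cs J h2)) hc) hw' hy ?_
    rw [mul_assoc, ← e, h3]; simp
  subst hy'
  have hc' : cs.wordProd ω' = v * cs.wordProd ω * v' := by
    rw [h3] at e; exact mul_right_cancel e
  have hQ' : Q ω' := by
    obtain ⟨p, hp, ep⟩ := Iset_conj cs δ J w hv
    obtain ⟨q, hq, eq⟩ := Iset_conj cs δ J y hv'
    refine ⟨h2, p, hp, q, hq, ?_⟩
    nth_rewrite 1 [hc']
    rw [map_mul, map_mul, ← mul_assoc, ← mul_assoc, ep, mul_assoc p, h3, mul_assoc, mul_assoc,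
      eq]
    simp only [mul_assoc]
  have := hmin _ hQ'
  exact (h5 (by omega)).1

end PCD

/-- `W` is the disjoint union, over the minimal coset representatives
`w ∈ ᴶW`, of the `δ`-twisted `W_J`-conjugation orbits `W_J ·_δ (W_{I(J,w,δ)} w)`. -/
theorem partial_conjugation_decomposition (cs : CoxeterSystem M W)
    (J J' : Set B) (δ : W ≃* W)
    (hδ : ∀ i ∈ J, ∃ i' ∈ J', δ (cs.simple i) = cs.simple i') :
    ∀ g : W, ∃! w : W, w ∈ MinCosetRep cs J ∧ g ∈ Piece cs (δ : W →* W) J w := by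
  intro g
  obtain ⟨w, hw, hg⟩ := PCD.existence cs J J' (δ : W →* W) hδ g
  exact ⟨w, ⟨hw, hg⟩, fun w' h => PCD.uniqueness cs J J' (δ : W →* W) hδ g w w' hw h.1 hg h.2⟩
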